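/- Assume (f) and (D1) with threshold α ∈ (0,1), let ℓ⁻ ∈ [0,α), ℓ⁺ ∈ (α,1], assume the chord conditions with common slope c, and let φ be the wavefront profile from ℓ⁻ to ℓ⁺ normalized by φ(0) = α, φ(ξ) < α for ξ < 0, φ(ξ) > α for ξ > 0. Set ξ_{ℓ⁻} := inf{ξ ∈ ℝ : φ(ξ) > ℓ⁻} ∈ [−∞, 0). Then for every ξ ∈ (ξ_{ℓ⁻}, 0) the profile is differentiable at ξ and φ′(ξ) = (f(φ(ξ)) − f(ℓ⁻) − c(φ(ξ) − ℓ⁻))/D(φ(ξ)) > 0. -/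

import Mathlib

open Set Filter MeasureTheory Topology

/-- A traveling-wave profile of `ρ_t + f(ρ)_x = (D(ρ)ρ_x)_x` with speed `c`:
a continuous `φ : ℝ → [0,1]`, differentiable off a countable set, with
`D(φ)φ'` locally integrable, satisfying the weak form of the profile ODE. -/
def IsTWProfile (f D : ℝ → ℝ) (c : ℝ) (φ : ℝ → ℝ) : Prop :=
  Continuous φ ∧ (∀ ξ, φ ξ ∈ Icc (0:ℝ) 1) ∧
  (∃ S : Set ℝ, S.Countable ∧ ∀ ξ ∉ S, DifferentiableAt ℝ φ ξ) ∧
  LocallyIntegrable (fun ξ => D (φ ξ) * deriv φ ξ) ∧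
  ∀ ψ : ℝ → ℝ, ContDiff ℝ (⊤ : ℕ∞) ψ → HasCompactSupport ψ →
    ∫ ξ, (D (φ ξ) * deriv φ ξ - f (φ ξ) + c * φ ξ) * deriv ψ ξ = 0

/-- A wavefront from `ℓm` to `ℓp`: a monotone, non-constant traveling-wave
profile with limits `ℓm` at `-∞` and `ℓp` at `+∞`. -/
def IsWavefront (f D : ℝ → ℝ) (c ℓm ℓp : ℝ) (φ : ℝ → ℝ) : Prop :=
  IsTWProfile f D c φ ∧ (Monotone φ ∨ Antitone φ) ∧ (∃ x y, φ x ≠ φ y) ∧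
  Tendsto φ atBot (𝓝 ℓm) ∧ Tendsto φ atTop (𝓝 ℓp)


lemma aux_primitive (η : ℝ → ℝ) (hη : ContDiff ℝ (⊤ : ℕ∞) η) (hc : HasCompactSupport η)
    (h0 : ∫ x, η x = 0) :
    ∃ ψ : ℝ → ℝ, ContDiff ℝ (⊤ : ℕ∞) ψ ∧ HasCompactSupport ψ ∧ deriv ψ = η := by
  obtain ⟨r, hr⟩ := hc.isCompact.isBounded.subset_closedBall (0:ℝ)
  have hz : ∀ x, r < |x| → η x = 0 := by
    intro x hx
    by_contra hne
    have := hr (subset_tsupport η hne)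
    rw [Metric.mem_closedBall, Real.dist_eq, sub_zero] at this
    linarith
  set R := |r| + 1 with hR
  have hrR : r < R := by have := le_abs_self r; linarith
  have hR0 : 0 < R := by positivity
  have hcont := hη.continuous
  have hder : ∀ x, HasDerivAt (fun x => ∫ t in (-R)..x, η t) (η x) x := fun x =>
    intervalIntegral.integral_hasDerivAt_right (hcont.intervalIntegrable _ _)
      (hcont.stronglyMeasurableAtFilter _ _) hcont.continuousAt
  have hd : deriv (fun x => ∫ t in (-R)..x, η t) = η := funext fun x => (hder x).deriv
  refine ⟨fun x => ∫ t in (-R)..x, η t, ?_, ?_, hd⟩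
  · refine contDiff_infty_iff_deriv.2 ⟨fun x => (hder x).differentiableAt, ?_⟩
    rw [hd]; exact hη
  · refine HasCompactSupport.intro (isCompact_Icc (a := -R) (b := R)) ?_
    intro x hx
    by_cases h1 : x < -R
    · show ∫ t in (-R)..x, η t = 0
      rw [intervalIntegral.integral_congr (g := fun _ => (0:ℝ))]
      · simp
      · intro t ht
        rw [uIcc_of_ge h1.le] at ht
        apply hz
        rw [lt_abs]; right; linarith [ht.2]
    · have h2 : R < x := by
        by_contra h
        exact hx ⟨not_lt.1 h1, not_lt.1 h⟩
      show ∫ t in (-R)..x, η t = 0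
      rw [intervalIntegral.integral_eq_integral_of_support_subset, h0]
      intro t ht
      by_contra hn
      apply ht
      apply hz
      rw [lt_abs]
      by_contra hh
      push Not at hh
      exact hn ⟨by linarith [hh.2], by linarith [hh.1]⟩

lemma aux_dubois (u : ℝ → ℝ) (hu : LocallyIntegrable u)
    (h : ∀ ψ : ℝ → ℝ, ContDiff ℝ (⊤ : ℕ∞) ψ → HasCompactSupport ψ →
      ∫ ξ, u ξ * deriv ψ ξ = 0) : ∃ K : ℝ, ∀ᵐ x, u x = K := by
  let b : ContDiffBump (0:ℝ) := default
  set χ : ℝ → ℝ := b.normed volume with hχ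
  have hχs : ContDiff ℝ (⊤ : ℕ∞) χ := b.contDiff_normed
  have hχc : HasCompactSupport χ := b.hasCompactSupport_normed
  have hχ1 : ∫ x, χ x = 1 := b.integral_normed
  have hint : ∀ g : ℝ → ℝ, ContDiff ℝ (⊤ : ℕ∞) g → HasCompactSupport g →
      Integrable (fun x => g x * u x) := fun g hg hgc =>
    hu.integrable_smul_left_of_hasCompactSupport hg.continuous hgc
  refine ⟨∫ x, χ x * u x, ?_⟩
  set K := ∫ x, χ x * u x with hK
  have key : ∀ᵐ x, u x - K = 0 := by
    refine ae_eq_zero_of_integral_contDiff_smul_eq_zero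
      (hu.sub (continuous_const (y := K)).locallyIntegrable) ?_
    intro g hg hgc
    have hgi : Integrable g := hg.continuous.integrable_of_hasCompactSupport hgc
    have hχi : Integrable χ := hχs.continuous.integrable_of_hasCompactSupport hχc
    obtain ⟨ψ, h1, h2, h3⟩ := aux_primitive (fun x => g x - (∫ y, g y) * χ x)
      (hg.sub (contDiff_const.mul hχs)) (hgc.sub (hχc.mul_left)) (by
        rw [integral_sub hgi (hχi.const_mul _), integral_const_mul, hχ1]; ring)
    have h4 := h ψ h1 h2
    rw [h3] at h4
    have e1 : ∫ ξ, u ξ * (g ξ - (∫ y, g y) * χ ξ) =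
        (∫ ξ, g ξ * u ξ) - (∫ y, g y) * K := by
      rw [hK, ← integral_const_mul, ← integral_sub (hint g hg hgc) ((hint χ hχs hχc).const_mul _)]
      congr 1; ext x; ring
    have e2 : ∫ x, g x • (u x - K) = (∫ ξ, g ξ * u ξ) - (∫ y, g y) * K := by
      rw [← integral_mul_const, ← integral_sub (hint g hg hgc) (hgi.mul_const _)]
      congr 1; ext x; simp only [smul_eq_mul]; ring
    show ∫ x, g x • (u x - K) = 0
    rw [e2, ← e1, h4]
  filter_upwards [key] with x hx
  linarith

lemma aux_limit (H w : ℝ → ℝ) (A L : ℝ) (hH : ∀ x, HasDerivAt H (w x) x)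
    (hA : Tendsto H atBot (𝓝 A)) (hL : Tendsto w atBot (𝓝 L)) : L = 0 := by
  have hm : ∀ x : ℝ, ∃ y ∈ Ioo x (x+1), w y = (H (x+1) - H x) / (x + 1 - x) := fun x =>
    exists_hasDerivAt_eq_slope H w (by linarith)
      (fun z _ => (hH z).continuousAt.continuousWithinAt) (fun z _ => hH z)
  choose y hy hw using hm
  have hs : Tendsto (fun x : ℝ => x + 1) atBot atBot := tendsto_atBot_add_const_right _ _ tendsto_id
  have hyb : Tendsto y atBot atBot := tendsto_atBot_mono (fun x => (hy x).2.le) hs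
  have t1 := hL.comp hyb
  have t2 : Tendsto (fun x => H (x+1) - H x) atBot (𝓝 (A - A)) := (hA.comp hs).sub hA
  rw [sub_self] at t2
  refine tendsto_nhds_unique t1 (t2.congr fun x => ?_)
  simp [hw]

lemma aux_inv (G φ : ℝ → ℝ) (ξ d w : ℝ) (hφ : ContinuousAt φ ξ) (hG : HasDerivAt G d (φ ξ))
    (hd : d ≠ 0) (hH : HasDerivAt (fun x => G (φ x)) w ξ) : HasDerivAt φ (w / d) ξ := by
  have hc : ContinuousAt (dslope G (φ ξ)) (φ ξ) :=
    continuousAt_dslope_same.2 hG.differentiableAt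
  have hds : dslope G (φ ξ) (φ ξ) = d := by rw [dslope_same, hG.deriv]
  have ht : Tendsto (fun x => dslope G (φ ξ) (φ x)) (𝓝 ξ) (𝓝 d) := by
    have := (ContinuousAt.comp (f := φ) (x := ξ) hc hφ).tendsto
    rwa [Function.comp_apply, hds] at this
  rw [hasDerivAt_iff_tendsto_slope] at hH ⊢
  refine (hH.div (ht.mono_left nhdsWithin_le_nhds) hd).congr' ?_
  filter_upwards [(ht.eventually_ne hd).filter_mono nhdsWithin_le_nhds] with x hx
  rw [Pi.div_apply, div_eq_iff hx, slope_def_field, slope_def_field]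
  have := sub_smul_dslope G (φ ξ) (φ x)
  rw [smul_eq_mul] at this
  simp only [← this]
  ring

/-- Formula (5.6): on `(ξ_{ℓ⁻}, 0)` (i.e. at those `ξ < 0` where `ℓ⁻ < φ ξ`)
the profile is differentiable with the explicit positive derivative. -/
theorem stmt15 (f D φ : ℝ → ℝ) (α ℓm ℓp c : ℝ)
    (hf : ContDiffOn ℝ 1 f (Icc 0 1)) (hf0 : f 0 = 0)
    (hD : ContDiffOn ℝ 1 D (Icc 0 1))
    (hα : α ∈ Ioo (0:ℝ) 1)
    (hDpos : ∀ ρ ∈ Ioo (0:ℝ) α, 0 < D ρ) (hDneg : ∀ ρ ∈ Ioo α 1, D ρ < 0)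
    (hℓm : ℓm ∈ Ico (0:ℝ) α) (hℓp : ℓp ∈ Ioc α 1)
    (hc1 : c = (f α - f ℓm) / (α - ℓm)) (hc2 : c = (f ℓp - f α) / (ℓp - α))
    (hchord1 : ∀ ρ ∈ Ioo ℓm α, f α + c * (ρ - α) < f ρ)
    (hchord2 : ∀ ρ ∈ Ioo α ℓp, f ρ < f α + c * (ρ - α))
    (hwf : IsWavefront f D c ℓm ℓp φ)
    (hnorm : φ 0 = α ∧ (∀ ξ < (0:ℝ), φ ξ < α) ∧ (∀ ξ > (0:ℝ), α < φ ξ)) :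
    ∀ ξ : ℝ, ξ < 0 → ℓm < φ ξ →
      DifferentiableAt ℝ φ ξ ∧
      deriv φ ξ = (f (φ ξ) - f ℓm - c * (φ ξ - ℓm)) / D (φ ξ) ∧
      0 < deriv φ ξ := by
  obtain ⟨⟨hφc, hφm, ⟨S, hS, hφd⟩, hli, hweak⟩, -, -, htm, -⟩ := hwf
  obtain ⟨-, hlt, -⟩ := hnorm
  intro ξ hξ hℓξ
  have h01 : (0:ℝ) ≤ 1 := zero_le_one
  have hDc : Continuous (IccExtend h01 ((Icc (0:ℝ) 1).domRestrict D)) :=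
    (continuousOn_iff_continuous_domRestrict.1 hD.continuousOn).Icc_extend'
  have hfc : Continuous (IccExtend h01 ((Icc (0:ℝ) 1).domRestrict f)) :=
    (continuousOn_iff_continuous_domRestrict.1 hf.continuousOn).Icc_extend'
  set E := IccExtend h01 ((Icc (0:ℝ) 1).domRestrict D) with hE
  set F := IccExtend h01 ((Icc (0:ℝ) 1).domRestrict f) with hF
  have hED : ∀ x ∈ Icc (0:ℝ) 1, E x = D x := fun x hx => by
    rw [hE, IccExtend_of_mem _ _ hx]; rfl
  have hFf : ∀ x ∈ Icc (0:ℝ) 1, F x = f x := fun x hx => by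
    rw [hF, IccExtend_of_mem _ _ hx]; rfl
  set G : ℝ → ℝ := fun x => ∫ t in (0:ℝ)..x, E t with hGdef
  have hG : ∀ x, HasDerivAt G (E x) x := fun x =>
    intervalIntegral.integral_hasDerivAt_right (hDc.intervalIntegrable _ _)
      (hDc.stronglyMeasurableAtFilter _ _) hDc.continuousAt
  have hGc : Continuous G := continuous_iff_continuousAt.2 fun x => (hG x).continuousAt
  have hwc : Continuous (fun x => F (φ x) - c * φ x) := by fun_prop
  obtain ⟨K, hK⟩ := aux_dubois (fun x => D (φ x) * deriv φ x - f (φ x) + c * φ x) (by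
      have := hli.sub hwc.locallyIntegrable
      convert this using 1
      ext x
      simp only [Pi.sub_apply, hFf _ (hφm x)]
      ring) hweak
  have hint : ∀ a b, ∫ x in a..b, D (φ x) * deriv φ x = G (φ b) - G (φ a) := fun a b => by
    refine integral_eq_of_hasDerivAt_off_countable (fun x => G (φ x)) _ hS
      (hGc.comp hφc).continuousOn ?_ ((hli.integrableOn_isCompact isCompact_uIcc).intervalIntegrable)
    intro x hx
    have := (hG (φ x)).comp x (hφd x hx.2).hasDerivAt
    rwa [hED _ (hφm x)] at this
  have hwc' : Continuous (fun x => F (φ x) - c * φ x + K) := by fun_prop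
  have hH : ∀ x, HasDerivAt (fun x => G (φ x)) (F (φ x) - c * φ x + K) x := by
    intro x
    have h1 : HasDerivAt (fun y => ∫ t in (0:ℝ)..y, (F (φ t) - c * φ t + K))
        (F (φ x) - c * φ x + K) x :=
      intervalIntegral.integral_hasDerivAt_right (hwc'.intervalIntegrable _ _)
        (hwc'.stronglyMeasurableAtFilter _ _) hwc'.continuousAt
    have h2 : (fun x => G (φ x)) =
        fun y => (∫ t in (0:ℝ)..y, (F (φ t) - c * φ t + K)) + G (φ 0) := by
      ext y
      have : ∫ x in (0:ℝ)..y, D (φ x) * deriv φ x =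
          ∫ t in (0:ℝ)..y, (F (φ t) - c * φ t + K) := by
        apply intervalIntegral.integral_congr_ae
        filter_upwards [hK] with t ht _
        rw [hFf _ (hφm t)]
        linarith
      rw [← this, hint]
      ring
    rw [h2]
    exact h1.add_const _
  have hℓ01 : ℓm ∈ Icc (0:ℝ) 1 := ⟨hℓm.1, by linarith [hℓm.2, hα.2]⟩
  have hL := aux_limit _ _ (G ℓm) (F ℓm - c * ℓm + K) hH
    ((hGc.tendsto _).comp htm)
    ((((hfc.tendsto _).comp htm).sub (htm.const_mul c)).add_const K)
  rw [hFf _ hℓ01] at hL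
  have hφα := hlt ξ hξ
  have hDp : 0 < D (φ ξ) := hDpos _ ⟨by linarith [hℓm.1], hφα⟩
  have hmain := aux_inv G φ ξ (D (φ ξ)) (f (φ ξ) - f ℓm - c * (φ ξ - ℓm)) hφc.continuousAt
    (by rw [← hED _ (hφm ξ)]; exact hG _) hDp.ne' (by
      convert hH ξ using 1
      rw [hFf _ (hφm ξ)]
      linarith)
  refine ⟨hmain.differentiableAt, hmain.deriv, ?_⟩
  rw [hmain.deriv]
  apply div_pos _ hDp
  have hch := hchord1 (φ ξ) ⟨hℓξ, hφα⟩
  have hne : α - ℓm ≠ 0 := (sub_pos.2 hℓm.2).ne'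
  rw [eq_div_iff hne] at hc1
  linarith
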